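/- Let K ≥ 1. There exists a constant C > 0 depending only on s, c₀ and K such that for every triple (ξ₁, ξ₂, ξ₃) of real numbers with ξ₁ + ξ₂ + ξ₃ = 0, α₃(ξ₁,ξ₂,ξ₃) ≠ 0, max(|ξ₁|,|ξ₂|,|ξ₃|) ≥ N/2 and |ξ₁| ≤ K·|ξ₂ − ξ₃|, one has |σ₃(ξ₁,ξ₂,ξ₃)| ≤ C·(max(|ξ₂|,|ξ₃|))^{2s−2}·N^{2−2s}, and in particular |σ₃(ξ₁,ξ₂,ξ₃)| ≤ C′ for a constant C′ depending only on s, c₀ and K. -/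

import Mathlib

open MeasureTheory Real

noncomputable section

/-- An admissible I-method multiplier `m`, with parameters `s`, `N`, `c₀`. -/
structure AdmissibleMultiplier (s N c₀ : ℝ) (m : ℝ → ℝ) : Prop where
  even : ∀ ξ : ℝ, m (-ξ) = m ξ
  smooth : ContDiff ℝ 2 m
  anti : ∀ ⦃a b : ℝ⦄, 0 ≤ a → a ≤ b → m b ≤ m a
  pos : ∀ ξ : ℝ, 0 < m ξ
  le_one : ∀ ξ : ℝ, m ξ ≤ 1
  eq_one : ∀ ξ : ℝ, |ξ| ≤ N → m ξ = 1
  eq_rpow : ∀ ξ : ℝ, 2 * N ≤ |ξ| → m ξ = N ^ (1 - s) * |ξ| ^ (s - 1)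
  cube_mono : ∀ ⦃a b : ℝ⦄, 0 ≤ a → a ≤ b → a ^ 3 * m a ^ 2 ≤ b ^ 3 * m b ^ 2
  deriv_le : ∀ ξ : ℝ, ξ ≠ 0 → |deriv m ξ| ≤ c₀ * m ξ / |ξ|
  deriv2_le : ∀ ξ : ℝ, ξ ≠ 0 → |deriv (deriv m) ξ| ≤ c₀ * m ξ / ξ ^ 2

/-- The denominator `α₃(ξ₁,ξ₂,ξ₃) = ξ₁³ + 4ξ₂³ + 4ξ₃³`. -/
def alpha3 (ξ₁ ξ₂ ξ₃ : ℝ) : ℝ := ξ₁ ^ 3 + 4 * ξ₂ ^ 3 + 4 * ξ₃ ^ 3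

/-- The multiplier `σ₃` associated with `m₁` (and `m₂(ξ) = m₁(2ξ)`); equal to `0`
by the junk-value convention where `α₃` vanishes. -/
def sigma3 (m₁ : ℝ → ℝ) (ξ₁ ξ₂ ξ₃ : ℝ) : ℝ :=
  (ξ₁ ^ 3 * m₁ ξ₁ ^ 2 + 4 * ξ₂ ^ 3 * m₁ (2 * ξ₂) ^ 2 + 4 * ξ₃ ^ 3 * m₁ (2 * ξ₃) ^ 2) /
    alpha3 ξ₁ ξ₂ ξ₃

/-- The denominator factors on the hyperplane `ξ₁ + ξ₂ + ξ₃ = 0`. -/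
theorem alpha3_eq_of_sum_eq_zero {ξ₁ ξ₂ ξ₃ : ℝ} (h : ξ₁ + ξ₂ + ξ₃ = 0) :
    alpha3 ξ₁ ξ₂ ξ₃ = -3 * ξ₁ * (ξ₂ - ξ₃) ^ 2 := by
  obtain rfl : ξ₁ = -(ξ₂ + ξ₃) := by linarith
  unfold alpha3
  ring

namespace AdmissibleMultiplier

variable {s N c₀ : ℝ} {m : ℝ → ℝ}

/-- `t² m(t)²` is controlled by the value of `R² (N / R)^(2 - 2s)` at any `R ≥ |t| / 2`. -/
theorem sq_mul_sq_le (hm : AdmissibleMultiplier s N c₀ m) (hs : 0 ≤ s) (hs1 : s ≤ 1)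
    (hN : 0 < N) {t R : ℝ} (hR : 0 < R) (ht : |t| ≤ 2 * R) :
    t ^ 2 * m t ^ 2 ≤ 4 * (R ^ 2 * (R ^ (2 * s - 2) * N ^ (2 - 2 * s))) := by
  have hscale : (2 * R) ^ (2 * s) * (2 * N) ^ (2 - 2 * s) =
      4 * (R ^ 2 * (R ^ (2 * s - 2) * N ^ (2 - 2 * s))) := by
    rw [mul_rpow two_pos.le hR.le, mul_rpow two_pos.le hN.le, ← mul_assoc (R ^ 2),
      ← rpow_natCast R 2, ← rpow_add hR]
    have h4 : (2 : ℝ) ^ (2 * s) * 2 ^ (2 - 2 * s) = 4 := by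
      rw [← rpow_add two_pos, show 2 * s + (2 - 2 * s) = ((2 : ℕ) : ℝ) by push_cast; ring,
        rpow_natCast]
      norm_num
    rw [show ((2 : ℕ) : ℝ) + (2 * s - 2) = 2 * s by push_cast; ring]
    linear_combination R ^ (2 * s) * N ^ (2 - 2 * s) * h4
  rw [← hscale]
  rcases eq_or_ne t 0 with rfl | ht0
  · simp only [ne_eq, OfNat.ofNat_ne_zero, not_false_eq_true, zero_pow, zero_mul]
    positivity
  have hpos : 0 < |t| := abs_pos.2 ht0
  have hRs : |t| ^ (2 * s) ≤ (2 * R) ^ (2 * s) := rpow_le_rpow hpos.le ht (by linarith)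
  rcases le_total (2 * N) |t| with h | h
  · have hval : t ^ 2 * m t ^ 2 = |t| ^ (2 * s) * N ^ (2 - 2 * s) := by
      rw [hm.eq_rpow t h, mul_pow, ← sq_abs t, ← rpow_natCast (N ^ (1 - s)),
        ← rpow_natCast (|t| ^ (s - 1)), ← rpow_natCast |t|, ← rpow_mul hN.le,
        ← rpow_mul hpos.le, mul_left_comm, ← rpow_add hpos, mul_comm]
      push_cast
      congr 2 <;> ring
    rw [hval]
    have : N ^ (2 - 2 * s) ≤ (2 * N) ^ (2 - 2 * s) :=
      rpow_le_rpow hN.le (by linarith) (by linarith)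
    gcongr
  · have hm1 : m t ^ 2 ≤ 1 := pow_le_one₀ (hm.pos t).le (hm.le_one t)
    have hsplit : t ^ 2 = |t| ^ (2 * s) * |t| ^ (2 - 2 * s) := by
      rw [← rpow_add hpos, ← sq_abs t, ← rpow_natCast]
      congr 1
      push_cast
      ring
    have hNs : |t| ^ (2 - 2 * s) ≤ (2 * N) ^ (2 - 2 * s) :=
      rpow_le_rpow hpos.le h (by linarith)
    calc t ^ 2 * m t ^ 2 ≤ t ^ 2 := mul_le_of_le_one_right (sq_nonneg t) hm1
      _ ≤ _ := by rw [hsplit]; gcongr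

theorem hasDerivAt_cube_mul_sq (hm : AdmissibleMultiplier s N c₀ m) (t : ℝ) :
    HasDerivAt (fun t ↦ t ^ 3 * m t ^ 2)
      (3 * t ^ 2 * m t ^ 2 + t ^ 3 * (2 * m t * deriv m t)) t := by
  have hd : HasDerivAt m (deriv m t) t :=
    (hm.smooth.differentiable (by norm_num) t).hasDerivAt
  refine ((hasDerivAt_pow 3 t).fun_mul (hd.fun_pow 2)).congr_deriv ?_
  norm_num

theorem abs_deriv_cube_mul_sq_le (hm : AdmissibleMultiplier s N c₀ m) (t : ℝ) :
    |3 * t ^ 2 * m t ^ 2 + t ^ 3 * (2 * m t * deriv m t)| ≤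
      (3 + 2 * c₀) * (t ^ 2 * m t ^ 2) := by
  rcases eq_or_ne t 0 with rfl | ht0
  · simp
  have hpos : 0 < |t| := abs_pos.2 ht0
  have hd := hm.deriv_le t ht0
  rw [le_div_iff₀ hpos] at hd
  have hmt := hm.pos t
  have h2 : |t ^ 3 * (2 * m t * deriv m t)| = 2 * t ^ 2 * m t * (|deriv m t| * |t|) := by
    rw [abs_mul, abs_mul, abs_mul, abs_pow, abs_of_pos hmt, abs_two, ← sq_abs t]
    ring
  calc |3 * t ^ 2 * m t ^ 2 + t ^ 3 * (2 * m t * deriv m t)|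
      ≤ |3 * t ^ 2 * m t ^ 2| + |t ^ 3 * (2 * m t * deriv m t)| := abs_add_le _ _
    _ = 3 * t ^ 2 * m t ^ 2 + 2 * t ^ 2 * m t * (|deriv m t| * |t|) := by
        rw [h2, abs_of_nonneg (by positivity)]
    _ ≤ 3 * t ^ 2 * m t ^ 2 + 2 * t ^ 2 * m t * (c₀ * m t) := by gcongr
    _ = (3 + 2 * c₀) * (t ^ 2 * m t ^ 2) := by ring

/-- `t ↦ t³ m(t)²` is Lipschitz on `[-2R, 2R]`, with the constant predicted by scaling. -/
theorem abs_cube_mul_sq_sub_le (hm : AdmissibleMultiplier s N c₀ m) (hs : 0 ≤ s) (hs1 : s ≤ 1)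
    (hN : 0 < N) (hc₀ : 0 ≤ c₀) {R x y : ℝ} (hR : 0 < R) (hx : |x| ≤ 2 * R) (hy : |y| ≤ 2 * R) :
    |x ^ 3 * m x ^ 2 - y ^ 3 * m y ^ 2| ≤
      (3 + 2 * c₀) * (4 * (R ^ 2 * (R ^ (2 * s - 2) * N ^ (2 - 2 * s)))) * |x - y| := by
  refine (convex_Icc (-(2 * R)) (2 * R)).norm_image_sub_le_of_norm_hasDerivWithin_le
    (f := fun t ↦ t ^ 3 * m t ^ 2)
    (fun t _ ↦ (hm.hasDerivAt_cube_mul_sq t).hasDerivWithinAt) (fun t ht ↦ ?_)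
    (abs_le.1 hy) (abs_le.1 hx)
  refine (hm.abs_deriv_cube_mul_sq_le t).trans ?_
  exact mul_le_mul_of_nonneg_left (hm.sq_mul_sq_le hs hs1 hN hR (abs_le.2 ht)) (by linarith)

end AdmissibleMultiplier

/-- Case (2) of Lemma 3.1: on the region `|ξ₁| ≲ |ξ₂ - ξ₃|` (with implicit constant `K`),
the multiplier `σ₃` is bounded by `C·(max(|ξ₂|,|ξ₃|))^{2s-2}·N^{2-2s}`, and in particular
by a constant `C'`, where `C, C'` depend only on `s`, `c₀` and `K`. -/
theorem sigma3_bound_case2 (s c₀ K : ℝ) (hs : 3 / 4 ≤ s) (hs1 : s < 1)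
    (hc₀ : 0 < c₀) (hK : 1 ≤ K) :
    ∃ C C' : ℝ, 0 < C ∧ 0 < C' ∧
      ∀ N : ℝ, 1 ≤ N → ∀ m₁ : ℝ → ℝ, AdmissibleMultiplier s N c₀ m₁ →
        ∀ ξ₁ ξ₂ ξ₃ : ℝ, ξ₁ + ξ₂ + ξ₃ = 0 → alpha3 ξ₁ ξ₂ ξ₃ ≠ 0 →
          N / 2 ≤ max |ξ₁| (max |ξ₂| |ξ₃|) → |ξ₁| ≤ K * |ξ₂ - ξ₃| →
          |sigma3 m₁ ξ₁ ξ₂ ξ₃| ≤ C * (max |ξ₂| |ξ₃|) ^ (2 * s - 2) * N ^ (2 - 2 * s) ∧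
          |sigma3 m₁ ξ₁ ξ₂ ξ₃| ≤ C' := by
  refine ⟨8 * (3 + 2 * c₀) * K ^ 2, 4 * (8 * (3 + 2 * c₀) * K ^ 2),
    by positivity, by positivity, ?_⟩
  intro N hN m hm ξ₁ ξ₂ ξ₃ hsum hα hmax hξ
  have hN0 : 0 < N := by linarith
  set M := max |ξ₂| |ξ₃| with hM
  have h2M : |ξ₂| ≤ M := le_max_left _ _
  have h3M : |ξ₃| ≤ M := le_max_right _ _
  have hξ₁ : ξ₁ = -(ξ₂ + ξ₃) := by linarith
  have h1M : |ξ₁| ≤ 2 * M := by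
    rw [hξ₁, abs_neg]
    linarith [abs_add_le ξ₂ ξ₃]
  have hNM : N ≤ 4 * M := by
    rcases le_max_iff.1 hmax with h | h <;> linarith
  have hM0 : 0 < M := by linarith
  have hMK : M ≤ K * |ξ₂ - ξ₃| := by
    have hsub : |ξ₂ - ξ₃| ≤ K * |ξ₂ - ξ₃| := le_mul_of_one_le_left (abs_nonneg _) hK
    rw [hξ₁, abs_neg] at hξ
    have h2 : |2 * ξ₂| ≤ |ξ₂ + ξ₃| + |ξ₂ - ξ₃| := by
      rw [show 2 * ξ₂ = (ξ₂ + ξ₃) + (ξ₂ - ξ₃) by ring]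
      exact abs_add_le _ _
    have h3 : |2 * ξ₃| ≤ |ξ₂ + ξ₃| + |ξ₂ - ξ₃| := by
      rw [show 2 * ξ₃ = (ξ₂ + ξ₃) - (ξ₂ - ξ₃) by ring]
      exact abs_sub _ _
    rw [abs_mul, abs_two] at h2 h3
    exact max_le (by linarith) (by linarith)
  set g := M ^ (2 * s - 2) * N ^ (2 - 2 * s) with hg
  have hg0 : 0 ≤ g := by positivity
  set B := (3 + 2 * c₀) * (4 * (M ^ 2 * g)) with hB
  have hB0 : 0 ≤ B := by positivity
  have hbound : |sigma3 m ξ₁ ξ₂ ξ₃| ≤ 8 * (3 + 2 * c₀) * K ^ 2 * g := by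
    have hlip {x y : ℝ} (hx : |x| ≤ 2 * M) (hy : |y| ≤ 2 * M) :
        |x ^ 3 * m x ^ 2 - y ^ 3 * m y ^ 2| ≤ B * |x - y| :=
      hm.abs_cube_mul_sq_sub_le (by linarith) hs1.le hN0 hc₀.le hM0 hx hy
    have hf1 := hlip h1M (y := 0) (by simp [hM0.le])
    have hf23 := hlip (x := 2 * ξ₂) (y := -(2 * ξ₃))
      (by rw [abs_mul, abs_two]; linarith) (by rw [abs_neg, abs_mul, abs_two]; linarith)
    have hdiff : |2 * ξ₂ - -(2 * ξ₃)| = 2 * |ξ₁| := by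
      rw [hξ₁, abs_neg, ← abs_two, ← abs_mul, abs_two]
      congr 1
      ring
    rw [hm.even, hdiff] at hf23
    have hnum : |ξ₁ ^ 3 * m ξ₁ ^ 2 + 4 * ξ₂ ^ 3 * m (2 * ξ₂) ^ 2 + 4 * ξ₃ ^ 3 * m (2 * ξ₃) ^ 2|
        ≤ 2 * B * |ξ₁| := by
      rw [abs_le] at *
      simp only [sub_zero, ne_eq, OfNat.ofNat_ne_zero, not_false_eq_true, zero_pow, zero_mul]
        at hf1
      constructor <;> linarith
    have hden := alpha3_eq_of_sum_eq_zero hsum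
    have hξ₁0 : 0 < |ξ₁| := by
      refine abs_pos.2 fun h ↦ hα ?_
      rw [hden, h]
      ring
    have hM2 : M ^ 2 ≤ K ^ 2 * (ξ₂ - ξ₃) ^ 2 := by
      rw [← sq_abs (ξ₂ - ξ₃), ← mul_pow]
      gcongr
    rw [sigma3, abs_div, div_le_iff₀ (abs_pos.2 hα), hden, abs_mul, abs_mul,
      abs_of_nonneg (sq_nonneg (ξ₂ - ξ₃))]
    norm_num only [abs_neg, abs_of_pos]
    calc _ ≤ 2 * B * |ξ₁| := hnum
      _ = 8 * (3 + 2 * c₀) * g * |ξ₁| * M ^ 2 := by rw [hB]; ring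
      _ ≤ 8 * (3 + 2 * c₀) * g * |ξ₁| * (K ^ 2 * (ξ₂ - ξ₃) ^ 2) := by gcongr
      _ ≤ 3 * (8 * (3 + 2 * c₀) * g * |ξ₁| * (K ^ 2 * (ξ₂ - ξ₃) ^ 2)) :=
        le_mul_of_one_le_left (by positivity) (by norm_num)
      _ = _ := by ring
  refine ⟨by rwa [mul_assoc _ (M ^ (2 * s - 2))], hbound.trans ?_⟩
  have hg4 : g ≤ 4 := by
    calc g = (N / M) ^ (2 - 2 * s) := by
          rw [hg, div_rpow hN0.le hM0.le, show 2 * s - 2 = -(2 - 2 * s) by ring,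
            rpow_neg hM0.le, inv_mul_eq_div]
      _ ≤ 4 ^ (2 - 2 * s) :=
          rpow_le_rpow (by positivity) ((div_le_iff₀ hM0).2 hNM) (by linarith)
      _ ≤ 4 ^ (1 : ℝ) := rpow_le_rpow_of_exponent_le (by norm_num) (by linarith)
      _ = 4 := rpow_one 4
  rw [mul_comm 4]
  gcongr
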